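/- arXiv:2308.12693 — 2 statements merged into one kernel-verified Lean document; each statement's English description precedes it below -/
import Mathlib

section
/- For every x ∈ Perm_I, the element x − Σ_{α ∈ Alt_I} TC^α_x · α of ℚ⟨Perm_I⟩ lies in M_I. Equivalently, when the class of x in ℚ⟨Perm_I⟩/M_I is written as a ℚ-linear combination of the classes of alternating permutations, the coefficient of each α ∈ Alt_I equals the topological coefficient TC^α_x. -/
noncomputable section

/-- A permutation on `I`: an injective `2*k`-tuple with values in `I`
(for `|I| = 2*k` this is exactly a bijection from `{1,…,2k}` to `I`). -/
def PermOn (k : ℕ) (I : Finset ℕ) : Type :=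
  {x : Fin (2 * k) → ℕ // Function.Injective x ∧ ∀ i, x i ∈ I}

/-- The set `S^x_i`, with `0`-based index `j` (so `j = i - 1`). -/
def Sset (k : ℕ) (x : Fin (2 * k) → ℕ) (j : Fin (2 * k)) : Finset ℕ :=
  insert (x j)
    ((Finset.univ.filter (fun t : Fin (2 * k) => (t : ℕ) < 2 * ((j : ℕ) / 2))).image x)

/-- `x` is subordinate to `y`: `S^x_{2i-1} ∈ {S^y_{2i-1}, S^y_{2i}}` for all `1 ≤ i ≤ k`. -/
def Subordinate (k : ℕ) (x y : Fin (2 * k) → ℕ) : Prop :=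
  ∀ i : ℕ, ∀ h : i < k,
    Sset k x ⟨2 * i, by omega⟩ = Sset k y ⟨2 * i, by omega⟩ ∨
    Sset k x ⟨2 * i, by omega⟩ = Sset k y ⟨2 * i + 1, by omega⟩

/-- Alternating permutation. -/
def IsAlt (k : ℕ) (x : Fin (2 * k) → ℕ) : Prop :=
  (∀ i : ℕ, ∀ h : i < k, x ⟨2 * i, by omega⟩ < x ⟨2 * i + 1, by omega⟩) ∧
  (∀ i : ℕ, ∀ h : i + 1 < k, x ⟨2 * i + 2, by omega⟩ < x ⟨2 * i + 1, by omega⟩)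

/-- Sum of the `m`-th block (0-based). -/
def blockSum (k : ℕ) (x : Fin (2 * k) → ℕ) (m : ℕ) (h : m < k) : ℕ :=
  x ⟨2 * m, by omega⟩ + x ⟨2 * m + 1, by omega⟩

/-- The order `≺`: lexicographic on block sums read from the last block. -/
def PermLt (k : ℕ) (x y : Fin (2 * k) → ℕ) : Prop :=
  ∃ j : ℕ, ∃ hj : j < k,
    blockSum k x (k - 1 - j) (by omega) < blockSum k y (k - 1 - j) (by omega) ∧
    ∀ i : ℕ, i < j →
      blockSum k x (k - 1 - i) (by omega) = blockSum k y (k - 1 - i) (by omega)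

/-- The subgroup `S^even_{2k}` generated by the transpositions `(2i-1, 2i)`, `1 ≤ i ≤ k`. -/
def Seven (k : ℕ) : Subgroup (Equiv.Perm (Fin (2 * k))) :=
  Subgroup.closure
    { σ | ∃ (i : ℕ) (h : i < k),
        σ = Equiv.swap (⟨2 * i, by omega⟩ : Fin (2 * k)) ⟨2 * i + 1, by omega⟩ }

/-- The subgroup `S^odd_{2k}` generated by the transpositions `(2i, 2i+1)`, `1 ≤ i ≤ k-1`. -/
def Sodd (k : ℕ) : Subgroup (Equiv.Perm (Fin (2 * k))) :=
  Subgroup.closure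
    { σ | ∃ (i : ℕ) (h : i + 1 < k),
        σ = Equiv.swap (⟨2 * i + 1, by omega⟩ : Fin (2 * k)) ⟨2 * i + 2, by omega⟩ }

/-- `set4 k x i p q r s` agrees with `x` except at the (0-based) positions
`2i, 2i+1, 2i+2, 2i+3`, where it takes the values `p, q, r, s`. -/
def set4 (k : ℕ) (x : Fin (2 * k) → ℕ) (i : ℕ) (p q r s : ℕ) : Fin (2 * k) → ℕ :=
  fun j =>
    if (j : ℕ) = 2 * i then p
    else if (j : ℕ) = 2 * i + 1 then q
    else if (j : ℕ) = 2 * i + 2 then r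
    else if (j : ℕ) = 2 * i + 3 then s
    else x j

/-- Generators of type (1): `x + x'` where `x'` interchanges the two values of a block of `x`. -/
def SwapSet (k : ℕ) (I : Finset ℕ) : Set (PermOn k I →₀ ℚ) :=
  { v | ∃ (x x' : PermOn k I) (i : ℕ) (h : i < k),
      x'.1 = x.1 ∘ (Equiv.swap (⟨2 * i, by omega⟩ : Fin (2 * k)) ⟨2 * i + 1, by omega⟩) ∧
      v = Finsupp.single x 1 + Finsupp.single x' 1 }

/-- Generators of type (2): the Garnir elements
`x(ab/cd) − x(ac/bd) + x(ad/bc) + x(bc/ad) − x(bd/ac) + x(cd/ab)`. -/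
def GarnirSet (k : ℕ) (I : Finset ℕ) : Set (PermOn k I →₀ ℚ) :=
  { v | ∃ (x y₁ y₂ y₃ y₄ y₅ : PermOn k I) (i : ℕ) (h : i + 1 < k),
      (y₁.1 = set4 k x.1 i (x.1 ⟨2 * i, by omega⟩) (x.1 ⟨2 * i + 2, by omega⟩)
          (x.1 ⟨2 * i + 1, by omega⟩) (x.1 ⟨2 * i + 3, by omega⟩) ∧
       y₂.1 = set4 k x.1 i (x.1 ⟨2 * i, by omega⟩) (x.1 ⟨2 * i + 3, by omega⟩)
          (x.1 ⟨2 * i + 1, by omega⟩) (x.1 ⟨2 * i + 2, by omega⟩) ∧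
       y₃.1 = set4 k x.1 i (x.1 ⟨2 * i + 1, by omega⟩) (x.1 ⟨2 * i + 2, by omega⟩)
          (x.1 ⟨2 * i, by omega⟩) (x.1 ⟨2 * i + 3, by omega⟩) ∧
       y₄.1 = set4 k x.1 i (x.1 ⟨2 * i + 1, by omega⟩) (x.1 ⟨2 * i + 3, by omega⟩)
          (x.1 ⟨2 * i, by omega⟩) (x.1 ⟨2 * i + 2, by omega⟩) ∧
       y₅.1 = set4 k x.1 i (x.1 ⟨2 * i + 2, by omega⟩) (x.1 ⟨2 * i + 3, by omega⟩)
          (x.1 ⟨2 * i, by omega⟩) (x.1 ⟨2 * i + 1, by omega⟩)) ∧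
      v = Finsupp.single x 1 - Finsupp.single y₁ 1 + Finsupp.single y₂ 1
          + Finsupp.single y₃ 1 - Finsupp.single y₄ 1 + Finsupp.single y₅ 1 }

/-- The subspace `M_I` of `ℚ⟨Perm_I⟩`. -/
def MI (k : ℕ) (I : Finset ℕ) : Submodule ℚ (PermOn k I →₀ ℚ) :=
  Submodule.span ℚ (SwapSet k I ∪ GarnirSet k I)

/-- The simplex `φ_I(x) = {S^x_1, S^x_3, …, S^x_{2k-1}}`. -/
def phiMap (k : ℕ) (x : Fin (2 * k) → ℕ) : Finset (Finset ℕ) :=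
  Finset.univ.image (fun i : Fin k => Sset k x ⟨2 * (i : ℕ), by have := i.isLt; omega⟩)

/-- The face `F(x, ε) = {S^x_{2i-1+ε_i} : 1 ≤ i ≤ k}`. -/
def Fface (k : ℕ) (x : Fin (2 * k) → ℕ) (ε : Fin k → Bool) : Finset (Finset ℕ) :=
  Finset.univ.image (fun i : Fin k =>
    Sset k x ⟨2 * (i : ℕ) + (if ε i then 1 else 0), by have := i.isLt; split <;> omega⟩)

/-- The chain `c(x) = Σ_ε (−1)^{ε_1+⋯+ε_k} e_{F(x,ε)}`. -/
def chain (k : ℕ) (x : Fin (2 * k) → ℕ) : Finset (Finset ℕ) →₀ ℚ :=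
  ∑ ε : Fin k → Bool,
    ((-1 : ℚ) ^ (∑ i : Fin k, (ε i).toNat)) • Finsupp.single (Fface k x ε) 1

/-- Directed walks from `α` to `x`, encoded as `(m, v)` with `v : Fin (m+1) → Perm_I`. -/
def Walks (k : ℕ) (I : Finset ℕ) (α x : PermOn k I) :
    Set ((m : ℕ) × (Fin (m + 1) → PermOn k I)) :=
  { w | 1 ≤ w.1 ∧ w.2 0 = α ∧ w.2 (Fin.last w.1) = x ∧
      (∀ j : ℕ, ∀ h : j < w.1,
        IsAlt k (w.2 ⟨j, by omega⟩).1 ∧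
        Subordinate k (w.2 ⟨j, by omega⟩).1 (w.2 ⟨j + 1, by omega⟩).1) ∧
      (∀ j : ℕ, ∀ h : j + 1 < w.1, w.2 ⟨j, by omega⟩ ≠ w.2 ⟨j + 1, by omega⟩) }

/-- `s_I(α, x) = 1` if the unique `τ ∈ S^even_{2k}` with `τ·σ·α = x` is an even
permutation, and `0` otherwise. -/
def sI (k : ℕ) (I : Finset ℕ) (α x : PermOn k I) : ℕ := by
  classical
  exact if (∃ (τ : Seven k) (σ : Sodd k),
      (∀ j, α.1 (σ.1 (τ.1 j)) = x.1 j) ∧ Equiv.Perm.sign τ.1 = 1)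
    then 1 else 0

/-- The weight `wt` of a walk. -/
def wtW (k : ℕ) (I : Finset ℕ) (w : (m : ℕ) × (Fin (m + 1) → PermOn k I)) : ℕ :=
  ∑ j : Fin w.1, sI k I (w.2 j.castSucc) (w.2 j.succ)

/-- The topological coefficient `TCoef^α_x = −Σ_{p ∈ P_I(α,x)} (−1)^{wt(p)}`. -/
def TCoef (k : ℕ) (I : Finset ℕ) (α x : PermOn k I) : ℚ :=
  - ∑ᶠ p ∈ Walks k I α x, (-1 : ℚ) ^ (wtW k I p)

/-- `z` is restrictable to `I₁` and `I₂`. -/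
def Restrictable (k l : ℕ) (I₁ I₂ : Finset ℕ) (z : Fin (2 * (k + l)) → ℕ) : Prop :=
  ∀ i : ℕ, ∀ h : i < k + l,
    (z ⟨2 * i, by omega⟩ ∈ I₁ ∧ z ⟨2 * i + 1, by omega⟩ ∈ I₁) ∨
    (z ⟨2 * i, by omega⟩ ∈ I₂ ∧ z ⟨2 * i + 1, by omega⟩ ∈ I₂)

/-- The map `Perm_I → Perm_{w(I)}`, `x ↦ w ∘ x`. -/
def wMap (k : ℕ) (I : Finset ℕ) (w : Equiv.Perm ℕ) (x : PermOn k I) :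
    PermOn k (I.image w) :=
  ⟨fun j => w (x.1 j),
   fun a b hab => x.2.1 (w.injective hab),
   fun j => Finset.mem_image_of_mem w (x.2.2 j)⟩

end

/-- The set of values of `x` in its first `i` blocks. -/
def blockPrefix (k : ℕ) (x : Fin (2 * k) → ℕ) (i : ℕ) : Finset ℕ :=
  (Finset.univ.filter (fun t : Fin (2 * k) => (t : ℕ) < 2 * i)).image x

theorem mem_blockPrefix {k : ℕ} {x : Fin (2 * k) → ℕ} {i v : ℕ} :
    v ∈ blockPrefix k x i ↔ ∃ t : Fin (2 * k), (t : ℕ) < 2 * i ∧ x t = v := by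
  simp [blockPrefix]

theorem blockPrefix_succ {k : ℕ} (x : Fin (2 * k) → ℕ) {i : ℕ} (h : i < k) :
    blockPrefix k x (i + 1) = insert (x ⟨2 * i, by omega⟩)
      (insert (x ⟨2 * i + 1, by omega⟩) (blockPrefix k x i)) := by
  ext v
  simp only [Finset.mem_insert, mem_blockPrefix]
  constructor
  · rintro ⟨t, ht, rfl⟩
    rcases (by omega : (t : ℕ) < 2 * i ∨ (t : ℕ) = 2 * i ∨ (t : ℕ) = 2 * i + 1) with h' | h' | h'
    · exact Or.inr (Or.inr ⟨t, h', rfl⟩)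
    · exact Or.inl (congrArg x (Fin.ext h'))
    · exact Or.inr (Or.inl (congrArg x (Fin.ext h')))
  · rintro (rfl | rfl | ⟨t, ht, rfl⟩)
    · exact ⟨_, by simp only; omega, rfl⟩
    · exact ⟨_, by simp only; omega, rfl⟩
    · exact ⟨t, by omega, rfl⟩

theorem Sset_left {k : ℕ} (x : Fin (2 * k) → ℕ) {i : ℕ} (h : i < k) :
    Sset k x ⟨2 * i, by omega⟩ = insert (x ⟨2 * i, by omega⟩) (blockPrefix k x i) := by
  simp only [Sset, blockPrefix, show 2 * i / 2 = i by omega]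

theorem Sset_right {k : ℕ} (x : Fin (2 * k) → ℕ) {i : ℕ} (h : i < k) :
    Sset k x ⟨2 * i + 1, by omega⟩ =
      insert (x ⟨2 * i + 1, by omega⟩) (blockPrefix k x i) := by
  simp only [Sset, blockPrefix, show (2 * i + 1) / 2 = i by omega]

theorem left_notMem_blockPrefix {k : ℕ} {x : Fin (2 * k) → ℕ} (hx : Function.Injective x)
    {i : ℕ} (h : i < k) : x ⟨2 * i, by omega⟩ ∉ blockPrefix k x i := by
  rw [mem_blockPrefix]
  rintro ⟨t, ht, hxt⟩
  have := congrArg Fin.val (hx hxt)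
  simp only at this
  omega

theorem right_notMem_blockPrefix {k : ℕ} {x : Fin (2 * k) → ℕ} (hx : Function.Injective x)
    {i : ℕ} (h : i < k) : x ⟨2 * i + 1, by omega⟩ ∉ blockPrefix k x i := by
  rw [mem_blockPrefix]
  rintro ⟨t, ht, hxt⟩
  have := congrArg Fin.val (hx hxt)
  simp only at this
  omega

theorem left_ne_right {k : ℕ} {x : Fin (2 * k) → ℕ} (hx : Function.Injective x)
    {i : ℕ} (h : i < k) : x ⟨2 * i, by omega⟩ ≠ x ⟨2 * i + 1, by omega⟩ := by
  intro hxt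
  have := congrArg Fin.val (hx hxt)
  simp only at this
  omega

theorem Sset_left_ne_right {k : ℕ} {x : Fin (2 * k) → ℕ} (hx : Function.Injective x)
    {i : ℕ} (h : i < k) :
    Sset k x ⟨2 * i, by omega⟩ ≠ Sset k x ⟨2 * i + 1, by omega⟩ := by
  rw [Sset_left x h, Sset_right x h]
  intro he
  have hm := he ▸ Finset.mem_insert_self (x ⟨2 * i, by omega⟩) (blockPrefix k x i)
  rcases Finset.mem_insert.1 hm with h' | h'
  · exact left_ne_right hx h h'
  · exact left_notMem_blockPrefix hx h h'

/-- Prefixes agree from block `m` on as soon as they agree at block `m` and the values at all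
later positions agree. -/
theorem blockPrefix_congr {k : ℕ} {x y : Fin (2 * k) → ℕ} {m : ℕ}
    (hm : blockPrefix k x m = blockPrefix k y m)
    (hxy : ∀ t : Fin (2 * k), 2 * m ≤ (t : ℕ) → x t = y t) :
    ∀ j, m ≤ j → j ≤ k → blockPrefix k x j = blockPrefix k y j := by
  intro j hj
  induction j, hj using Nat.le_induction with
  | base => exact fun _ => hm
  | succ j hj ih =>
    intro hjk
    rw [blockPrefix_succ x (by omega), blockPrefix_succ y (by omega), ih (by omega),
      hxy _ (by simp only; omega), hxy _ (by simp only; omega)]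

theorem blockPrefix_congr_of_lt {k : ℕ} {x y : Fin (2 * k) → ℕ} {m : ℕ}
    (hxy : ∀ t : Fin (2 * k), (t : ℕ) < 2 * m → x t = y t) :
    blockPrefix k x m = blockPrefix k y m := by
  ext v
  simp only [mem_blockPrefix]
  exact exists_congr fun t => and_congr_right fun ht => by rw [hxy t ht]

/-- The contribution of block `i` of `x` to `subSign`, relative to a set `T`. -/
noncomputable def subFactor (k : ℕ) (T : Finset ℕ) (x : Fin (2 * k) → ℕ) (i : Fin k) : ℚ :=
  (if T = Sset k x ⟨2 * i, by omega⟩ then 1 else 0) -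
    (if T = Sset k x ⟨2 * i + 1, by omega⟩ then 1 else 0)

/-- The sign with which `a` is subordinate to `x`, and `0` if it is not. -/
noncomputable def subSign (k : ℕ) (a x : Fin (2 * k) → ℕ) : ℚ :=
  ∏ i : Fin k, subFactor k (Sset k a ⟨2 * i, by omega⟩) x i

theorem subFactor_eq {k : ℕ} (T : Finset ℕ) (x : Fin (2 * k) → ℕ) (i : Fin k) :
    subFactor k T x i =
      (if T = insert (x ⟨2 * i, by omega⟩) (blockPrefix k x i) then 1 else 0) -
      (if T = insert (x ⟨2 * i + 1, by omega⟩) (blockPrefix k x i) then 1 else 0) := by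
  rw [subFactor, Sset_left x i.2, Sset_right x i.2]

theorem subFactor_congr {k : ℕ} (T : Finset ℕ) {x y : Fin (2 * k) → ℕ} {i : Fin k}
    (hp : blockPrefix k x i = blockPrefix k y i)
    (h₀ : x ⟨2 * i, by omega⟩ = y ⟨2 * i, by omega⟩)
    (h₁ : x ⟨2 * i + 1, by omega⟩ = y ⟨2 * i + 1, by omega⟩) :
    subFactor k T x i = subFactor k T y i := by
  rw [subFactor_eq, subFactor_eq, hp, h₀, h₁]

theorem subordinate_of_subSign_ne_zero {k : ℕ} {a x : Fin (2 * k) → ℕ}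
    (h : subSign k a x ≠ 0) : Subordinate k a x := by
  intro i hi
  have := Finset.prod_ne_zero_iff.1 h ⟨i, hi⟩ (Finset.mem_univ _)
  by_contra hc
  rw [not_or] at hc
  exact this (by rw [subFactor, if_neg hc.1, if_neg hc.2, sub_zero])

theorem subSign_self {k : ℕ} {x : Fin (2 * k) → ℕ} (hx : Function.Injective x) :
    subSign k x x = 1 := by
  refine Finset.prod_eq_one fun i _ => ?_
  rw [subFactor, if_pos rfl, if_neg (Sset_left_ne_right hx i.2), sub_zero]

theorem blockPrefix_comp_perm {k : ℕ} (x : Fin (2 * k) → ℕ) (e : Equiv.Perm (Fin (2 * k)))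
    {j : ℕ} (he : ∀ t, (e t : ℕ) < 2 * j ↔ (t : ℕ) < 2 * j) :
    blockPrefix k (x ∘ e) j = blockPrefix k x j := by
  ext v
  simp only [mem_blockPrefix, Function.comp]
  constructor
  · rintro ⟨t, ht, rfl⟩
    exact ⟨e t, (he t).2 ht, rfl⟩
  · rintro ⟨t, ht, rfl⟩
    refine ⟨e.symm t, (he _).1 ?_, ?_⟩ <;> simp [ht]

theorem blockPrefix_comp_blockSwap {k : ℕ} (x : Fin (2 * k) → ℕ) {i : ℕ} (h : i < k) (j : ℕ) :
    blockPrefix k (x ∘ Equiv.swap (⟨2 * i, by omega⟩ : Fin (2 * k)) ⟨2 * i + 1, by omega⟩) j =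
      blockPrefix k x j := by
  refine blockPrefix_comp_perm x _ fun t => ?_
  rw [Equiv.swap_apply_def]
  split_ifs with h₁ h₂
  · subst h₁; simp only; omega
  · subst h₂; simp only; omega
  · rfl

theorem comp_blockSwap_of_ne {k : ℕ} (x : Fin (2 * k) → ℕ) {i : ℕ} (h : i < k)
    {t : Fin (2 * k)} (h₀ : (t : ℕ) ≠ 2 * i) (h₁ : (t : ℕ) ≠ 2 * i + 1) :
    (x ∘ Equiv.swap (⟨2 * i, by omega⟩ : Fin (2 * k)) ⟨2 * i + 1, by omega⟩) t = x t := by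
  rw [Function.comp, Equiv.swap_apply_of_ne_of_ne] <;> simpa [Fin.ext_iff]

theorem subSign_comp_blockSwap {k : ℕ} (a x : Fin (2 * k) → ℕ) {i : ℕ} (h : i < k) :
    subSign k a (x ∘ Equiv.swap (⟨2 * i, by omega⟩ : Fin (2 * k)) ⟨2 * i + 1, by omega⟩) =
      -subSign k a x := by
  unfold subSign
  rw [← Finset.mul_prod_erase _ _ (Finset.mem_univ (⟨i, h⟩ : Fin k)),
    ← Finset.mul_prod_erase Finset.univ (fun j : Fin k => subFactor k _ x j)
      (Finset.mem_univ (⟨i, h⟩ : Fin k)), ← neg_mul]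
  congr 1
  · rw [subFactor_eq, subFactor_eq, blockPrefix_comp_blockSwap x h]
    simp
  · refine Finset.prod_congr rfl fun j hj => ?_
    have hji : (j : ℕ) ≠ i := fun hc => (Finset.mem_erase.1 hj).1 (Fin.ext hc)
    exact subFactor_congr _ (blockPrefix_comp_blockSwap x h j)
      (comp_blockSwap_of_ne x h (by simp only; omega) (by simp only; omega))
      (comp_blockSwap_of_ne x h (by simp only; omega) (by simp only; omega))

theorem perm_apply_inv_apply {α : Type*} (σ : Equiv.Perm α) (t : α) : σ (σ⁻¹ t) = t :=
  σ.apply_symm_apply t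

theorem mem_Sset_left {k : ℕ} {x : Fin (2 * k) → ℕ} {i v : ℕ} (h : i < k) :
    v ∈ Sset k x ⟨2 * i, by omega⟩ ↔ ∃ t : Fin (2 * k), (t : ℕ) ≤ 2 * i ∧ x t = v := by
  rw [Sset_left x h, Finset.mem_insert, mem_blockPrefix]
  constructor
  · rintro (rfl | ⟨t, ht, rfl⟩)
    · exact ⟨_, le_rfl, rfl⟩
    · exact ⟨t, ht.le, rfl⟩
  · rintro ⟨t, ht, rfl⟩
    rcases ht.lt_or_eq with h' | h'
    · exact Or.inr ⟨t, h', rfl⟩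
    · exact Or.inl (congrArg x (Fin.ext h'))

theorem subSign_comp_of_mem_Seven {k : ℕ} (a : Fin (2 * k) → ℕ)
    {τ : Equiv.Perm (Fin (2 * k))} (hτ : τ ∈ Seven k) :
    ∀ x : Fin (2 * k) → ℕ,
      subSign k a (x ∘ τ) = ((Equiv.Perm.sign τ : ℤ) : ℚ) * subSign k a x := by
  induction hτ using Subgroup.closure_induction with
  | mem τ hτ =>
    obtain ⟨i, h, rfl⟩ := hτ
    intro x
    rw [subSign_comp_blockSwap, Equiv.Perm.sign_swap (by simp [Fin.ext_iff])]
    · simp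
    · exact h
  | one => intro x; simp
  | mul τ₁ τ₂ _ _ h₁ h₂ =>
    intro x
    rw [Equiv.Perm.coe_mul, ← Function.comp_assoc, h₂, h₁, Equiv.Perm.sign_mul]
    push_cast
    ring
  | inv τ _ h =>
    intro x
    have hx := h (x ∘ ⇑τ⁻¹)
    rw [Function.comp_assoc, ← Equiv.Perm.coe_mul, inv_mul_cancel, Equiv.Perm.coe_one,
      Function.comp_id] at hx
    rw [hx, ← mul_assoc, Equiv.Perm.sign_inv, ← Int.cast_mul, Int.units_coe_mul_self, Int.cast_one,
      one_mul]

theorem le_iff_of_mem_Sodd {k : ℕ} {σ : Equiv.Perm (Fin (2 * k))} (hσ : σ ∈ Sodd k) (i : ℕ) :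
    ∀ t, (σ t : ℕ) ≤ 2 * i ↔ (t : ℕ) ≤ 2 * i := by
  induction hσ using Subgroup.closure_induction with
  | mem σ hσ =>
    obtain ⟨j, h, rfl⟩ := hσ
    intro t
    rw [Equiv.swap_apply_def]
    split_ifs with h₁ h₂
    · subst h₁; simp only; omega
    · subst h₂; simp only; omega
    · rfl
  | one => intro t; rfl
  | mul σ₁ σ₂ _ _ h₁ h₂ => intro t; rw [Equiv.Perm.mul_apply, h₁, h₂]
  | inv σ _ h => intro t; rw [← h, perm_apply_inv_apply]

theorem Sset_left_comp_of_mem_Sodd {k : ℕ} (x : Fin (2 * k) → ℕ)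
    {σ : Equiv.Perm (Fin (2 * k))} (hσ : σ ∈ Sodd k) {i : ℕ} (h : i < k) :
    Sset k (x ∘ σ) ⟨2 * i, by omega⟩ = Sset k x ⟨2 * i, by omega⟩ := by
  ext v
  rw [mem_Sset_left h, mem_Sset_left h]
  constructor
  · rintro ⟨t, ht, rfl⟩
    exact ⟨σ t, (le_iff_of_mem_Sodd hσ i t).2 ht, rfl⟩
  · rintro ⟨t, ht, rfl⟩
    refine ⟨σ⁻¹ t, (le_iff_of_mem_Sodd (inv_mem hσ) i t).2 ht, ?_⟩
    rw [Function.comp, perm_apply_inv_apply]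

theorem subSign_comp_comp {k : ℕ} {a : Fin (2 * k) → ℕ} (ha : Function.Injective a)
    {σ τ : Equiv.Perm (Fin (2 * k))} (hσ : σ ∈ Sodd k) (hτ : τ ∈ Seven k) :
    subSign k a (a ∘ σ ∘ τ) = ((Equiv.Perm.sign τ : ℤ) : ℚ) := by
  have h : subSign k a (a ∘ σ) = subSign k (a ∘ σ) (a ∘ σ) :=
    Finset.prod_congr rfl fun i _ => by rw [Sset_left_comp_of_mem_Sodd a hσ i.2]
  rw [← Function.comp_assoc, subSign_comp_of_mem_Seven a hτ, h,
    subSign_self (ha.comp σ.injective), mul_one]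

theorem exists_Seven_Sset_eq {k : ℕ} {a x : Fin (2 * k) → ℕ} (hax : Subordinate k a x) (n : ℕ) :
    ∃ τ ∈ Seven k, Subordinate k a (x ∘ τ) ∧ ∀ i, ∀ h : i < k, i < n →
      Sset k a ⟨2 * i, by omega⟩ = Sset k (x ∘ τ) ⟨2 * i, by omega⟩ := by
  induction n with
  | zero => exact ⟨1, one_mem _, hax, fun i _ h => absurd h (Nat.not_lt_zero i)⟩
  | succ n ih =>
    obtain ⟨τ, hτ, hsub, heq⟩ := ih
    by_cases hn : n < k
    · rcases hsub n hn with hl | hr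
      · refine ⟨τ, hτ, hsub, fun i hi hin => ?_⟩
        rcases (by omega : i < n ∨ i = n) with h | rfl
        · exact heq i hi h
        · exact hl
      · have hcomp : x ∘ ⇑(τ * Equiv.swap (⟨2 * n, by omega⟩ : Fin (2 * k)) ⟨2 * n + 1, by omega⟩)
            = (x ∘ τ) ∘ Equiv.swap (⟨2 * n, by omega⟩ : Fin (2 * k)) ⟨2 * n + 1, by omega⟩ := rfl
        generalize x ∘ τ = z at *
        have hother : ∀ i, ∀ hi : i < k, i ≠ n →
            Sset k (z ∘ Equiv.swap (⟨2 * n, by omega⟩ : Fin (2 * k)) ⟨2 * n + 1, by omega⟩)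
              ⟨2 * i, by omega⟩ = Sset k z ⟨2 * i, by omega⟩ ∧
            Sset k (z ∘ Equiv.swap (⟨2 * n, by omega⟩ : Fin (2 * k)) ⟨2 * n + 1, by omega⟩)
              ⟨2 * i + 1, by omega⟩ = Sset k z ⟨2 * i + 1, by omega⟩ := by
          intro i hi hin
          rw [Sset_left _ hi, Sset_left _ hi, Sset_right _ hi, Sset_right _ hi,
            blockPrefix_comp_blockSwap z hn, comp_blockSwap_of_ne z hn, comp_blockSwap_of_ne z hn]
          · exact ⟨rfl, rfl⟩
          all_goals simp only; omega
        have hself : Sset k a ⟨2 * n, by omega⟩ =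
            Sset k (z ∘ Equiv.swap (⟨2 * n, by omega⟩ : Fin (2 * k)) ⟨2 * n + 1, by omega⟩)
              ⟨2 * n, by omega⟩ := by
          rw [hr, Sset_left _ hn, Sset_right _ hn, blockPrefix_comp_blockSwap z hn,
            Function.comp, Equiv.swap_apply_left]
        refine ⟨_, mul_mem hτ (Subgroup.subset_closure ⟨n, hn, rfl⟩), ?_, ?_⟩
        · intro i hi
          rw [hcomp]
          by_cases hin : i = n
          · subst hin
            exact Or.inl hself
          · rw [(hother i hi hin).1, (hother i hi hin).2]
            exact hsub i hi
        · intro i hi hin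
          rw [hcomp]
          rcases (by omega : i < n ∨ i = n) with h | rfl
          · rw [(hother i hi h.ne).1]
            exact heq i hi h
          · exact hself
    · exact ⟨τ, hτ, hsub, fun i hi _ => heq i hi (by omega)⟩

theorem exists_Sodd_eq_of_le {k : ℕ} {a z : Fin (2 * k) → ℕ} (ha : Function.Injective a)
    (haz : ∀ i, ∀ h : i < k, Sset k a ⟨2 * i, by omega⟩ = Sset k z ⟨2 * i, by omega⟩) (n : ℕ)
    (hn : n < k) : ∃ σ ∈ Sodd k, ∀ t : Fin (2 * k), (t : ℕ) ≤ 2 * n → a (σ t) = z t := by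
  induction n with
  | zero =>
    refine ⟨1, one_mem _, fun t ht => ?_⟩
    have h := (mem_Sset_left hn).1 (haz 0 hn ▸ (mem_Sset_left hn).2 ⟨t, ht, rfl⟩)
    obtain ⟨s, hs, hst⟩ := h
    rw [← Fin.ext (by omega : (s : ℕ) = t), Equiv.Perm.one_apply, hst,
      Fin.ext (by omega : (s : ℕ) = t)]
  | succ n ih =>
    obtain ⟨σ, hσ, heq⟩ := ih (by omega)
    have hb : Function.Injective (a ∘ σ) := ha.comp σ.injective
    have key : ∀ t : Fin (2 * k), 2 * n < (t : ℕ) → (t : ℕ) ≤ 2 * (n + 1) →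
        ∃ s : Fin (2 * k), 2 * n < (s : ℕ) ∧ (s : ℕ) ≤ 2 * (n + 1) ∧ z s = a (σ t) := by
      intro t ht₁ ht₂
      have h := (mem_Sset_left (x := a ∘ σ) hn).2 ⟨t, ht₂, rfl⟩
      rw [Sset_left_comp_of_mem_Sodd a hσ hn, haz _ hn, mem_Sset_left hn] at h
      obtain ⟨s, hs, hst⟩ := h
      refine ⟨s, ?_, hs, hst⟩
      by_contra hc
      have := hb ((heq s (by omega)).trans hst)
      subst this
      exact hc ht₁
    set p : Fin (2 * k) := ⟨2 * n + 1, by omega⟩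
    set q : Fin (2 * k) := ⟨2 * n + 2, by omega⟩
    have cases_pq : ∀ s : Fin (2 * k), 2 * n < (s : ℕ) → (s : ℕ) ≤ 2 * (n + 1) → s = p ∨ s = q := by
      intro s hs₁ hs₂
      simp only [p, q, Fin.ext_iff]
      omega
    have hpq : p ≠ q := by simp [p, q]
    obtain ⟨s, hs₁, hs₂, hs⟩ := key p (by simp [p]) (by simp only [p]; omega)
    obtain ⟨r, hr₁, hr₂, hr⟩ := key q (by simp [q]) (by simp only [q]; omega)
    have hsr : s ≠ r := by
      rintro rfl
      exact hpq (hb (hs.symm.trans hr))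
    have hother : ∀ t : Fin (2 * k), (t : ℕ) ≤ 2 * n → t ≠ p ∧ t ≠ q := by
      intro t ht
      simp only [p, q, ne_eq, Fin.ext_iff]
      omega
    rcases cases_pq s hs₁ hs₂ with rfl | rfl
    · obtain rfl : r = q := (cases_pq r hr₁ hr₂).resolve_left hsr.symm
      refine ⟨σ, hσ, fun t ht => ?_⟩
      by_cases htn : (t : ℕ) ≤ 2 * n
      · exact heq t htn
      · rcases cases_pq t (by omega) ht with rfl | rfl
        · exact hs.symm
        · exact hr.symm
    · obtain rfl : r = p := (cases_pq r hr₁ hr₂).resolve_right hsr.symm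
      refine ⟨σ * Equiv.swap p q, mul_mem hσ (Subgroup.subset_closure ⟨n, hn, rfl⟩),
        fun t ht => ?_⟩
      rw [Equiv.Perm.mul_apply]
      by_cases htn : (t : ℕ) ≤ 2 * n
      · rw [Equiv.swap_apply_of_ne_of_ne (hother t htn).1 (hother t htn).2, heq t htn]
      · rcases cases_pq t (by omega) ht with rfl | rfl
        · rw [Equiv.swap_apply_left, hr]
        · rw [Equiv.swap_apply_right, hs]

theorem PermOn.exists_eq {k : ℕ} {I : Finset ℕ} (hI : I.card = 2 * k) (x : PermOn k I) {v : ℕ}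
    (hv : v ∈ I) : ∃ t, x.1 t = v := by
  have h : Finset.univ.image x.1 = I := by
    refine Finset.eq_of_subset_of_card_le ?_ ?_
    · intro w hw
      obtain ⟨t, _, rfl⟩ := Finset.mem_image.1 hw
      exact x.2.2 t
    · rw [Finset.card_image_of_injective _ x.2.1, hI]
      simp
  rw [← h] at hv
  obtain ⟨t, _, ht⟩ := Finset.mem_image.1 hv
  exact ⟨t, ht⟩

theorem Subordinate.exists_comp {k : ℕ} {I : Finset ℕ} (hI : I.card = 2 * k) {a x : PermOn k I}
    (hax : Subordinate k a.1 x.1) : ∃ τ ∈ Seven k, ∃ σ ∈ Sodd k, a.1 ∘ σ ∘ τ = x.1 := by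
  rcases Nat.eq_zero_or_pos k with rfl | hk
  · exact ⟨1, one_mem _, 1, one_mem _, funext fun t => absurd t.2 (by omega)⟩
  obtain ⟨τ, hτ, -, heq⟩ := exists_Seven_Sset_eq hax k
  obtain ⟨σ, hσ, hσz⟩ := exists_Sodd_eq_of_le a.2.1 (fun i h => heq i h h) (k - 1) (by omega)
  have hall : ∀ t, a.1 (σ t) = (x.1 ∘ τ) t := by
    intro t
    by_cases ht : (t : ℕ) ≤ 2 * (k - 1)
    · exact hσz t ht
    · obtain ⟨s, hs⟩ := x.exists_eq hI (a.2.2 (σ t))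
      have hz : (x.1 ∘ τ) (τ⁻¹ s) = a.1 (σ t) := by
        rw [Function.comp, perm_apply_inv_apply, hs]
      have hst : τ⁻¹ s = t := by
        by_cases hs' : (τ⁻¹ s : ℕ) ≤ 2 * (k - 1)
        · exact σ.injective (a.2.1 ((hσz _ hs').trans hz))
        · exact Fin.ext (by omega)
      rw [← hz, hst]
  refine ⟨τ⁻¹, inv_mem hτ, σ, hσ, funext fun t => ?_⟩
  rw [Function.comp, Function.comp, hall, Function.comp, perm_apply_inv_apply]

theorem neg_one_pow_sI {k : ℕ} {I : Finset ℕ} (hI : I.card = 2 * k) {a x : PermOn k I}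
    (hax : Subordinate k a.1 x.1) : (-1 : ℚ) ^ sI k I a x = -subSign k a.1 x.1 := by
  have hsign : ∀ τ ∈ Seven k, ∀ σ ∈ Sodd k, a.1 ∘ σ ∘ τ = x.1 →
      subSign k a.1 x.1 = ((Equiv.Perm.sign τ : ℤ) : ℚ) := fun τ hτ σ hσ h => by
    rw [← h, subSign_comp_comp a.2.1 hσ hτ]
  unfold sI
  split_ifs with h
  · obtain ⟨τ, σ, he, hs⟩ := h
    rw [hsign τ τ.2 σ σ.2 (funext he), hs]
    simp
  · obtain ⟨τ, hτ, σ, hσ, he⟩ := hax.exists_comp hI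
    rw [hsign τ hτ σ hσ he]
    rcases Int.units_eq_one_or (Equiv.Perm.sign τ) with hs | hs
    · exact absurd ⟨⟨τ, hτ⟩, ⟨σ, hσ⟩, congrFun he, hs⟩ h
    · rw [hs]
      simp

instance PermOn.finite (k : ℕ) (I : Finset ℕ) : Finite (PermOn k I) :=
  Finite.of_injective (fun (x : PermOn k I) (t : Fin (2 * k)) => (⟨x.1 t, x.2.2 t⟩ : I))
    fun _ _ h => Subtype.ext (funext fun t => congrArg Subtype.val (congrFun h t))

theorem blockPrefix_self {k : ℕ} {I : Finset ℕ} (hI : I.card = 2 * k) (x : PermOn k I) :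
    blockPrefix k x.1 k = I := by
  ext v
  rw [mem_blockPrefix]
  constructor
  · rintro ⟨t, _, rfl⟩
    exact x.2.2 t
  · intro hv
    obtain ⟨t, ht⟩ := x.exists_eq hI hv
    exact ⟨t, t.2, ht⟩

/-- The sum, over all prefixes, of the values in a prefix. -/
def prefixWeight (k : ℕ) (x : Fin (2 * k) → ℕ) : ℕ :=
  ∑ i ∈ Finset.range k, ∑ v ∈ blockPrefix k x (i + 1), v

theorem IsAlt.eq_of_blockPrefix_eq {k : ℕ} {a b : Fin (2 * k) → ℕ} (ha : IsAlt k a)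
    (hb : IsAlt k b) (hai : Function.Injective a) (hbi : Function.Injective b)
    (h : ∀ i ≤ k, blockPrefix k a i = blockPrefix k b i) : a = b := by
  have key : ∀ i, ∀ hi : i < k, a ⟨2 * i, by omega⟩ = b ⟨2 * i, by omega⟩ ∧
      a ⟨2 * i + 1, by omega⟩ = b ⟨2 * i + 1, by omega⟩ := by
    intro i hi
    have h₀ := h i hi.le
    have h₁ := h (i + 1) hi
    rw [blockPrefix_succ a hi, blockPrefix_succ b hi, h₀] at h₁
    have hal := left_notMem_blockPrefix hai hi
    have har := right_notMem_blockPrefix hai hi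
    have hbl := left_notMem_blockPrefix hbi hi
    have hbr := right_notMem_blockPrefix hbi hi
    rw [h₀] at hal har
    have hA := ha.1 i hi
    have hB := hb.1 i hi
    have m₁ := (Finset.ext_iff.1 h₁ (a ⟨2 * i, by omega⟩)).1 (by simp)
    have m₂ := (Finset.ext_iff.1 h₁ (a ⟨2 * i + 1, by omega⟩)).1 (by simp)
    simp only [Finset.mem_insert, hal, har, or_false] at m₁ m₂
    omega
  funext t
  rcases Nat.even_or_odd' (t : ℕ) with ⟨i, hi | hi⟩
  · rw [Fin.ext (a := t) (b := ⟨2 * i, by omega⟩) hi]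
    exact (key i (by omega)).1
  · rw [Fin.ext (a := t) (b := ⟨2 * i + 1, by omega⟩) hi]
    exact (key i (by omega)).2

theorem Subordinate.sum_blockPrefix_le {k : ℕ} {a b : Fin (2 * k) → ℕ} (ha : IsAlt k a)
    (hai : Function.Injective a) (hbi : Function.Injective b) (hab : Subordinate k a b)
    {i : ℕ} (hi : i + 1 < k) :
    ∑ v ∈ blockPrefix k b (i + 1), v ≤ ∑ v ∈ blockPrefix k a (i + 1), v ∧
      (∑ v ∈ blockPrefix k b (i + 1), v = ∑ v ∈ blockPrefix k a (i + 1), v →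
        blockPrefix k a (i + 1) = blockPrefix k b (i + 1)) := by
  have hi' : i < k := by omega
  obtain ⟨o, ho, hbo⟩ : ∃ o, o ∉ Sset k a ⟨2 * i, by omega⟩ ∧
      blockPrefix k b (i + 1) = insert o (Sset k a ⟨2 * i, by omega⟩) := by
    rcases hab i hi' with h | h
    · refine ⟨b ⟨2 * i + 1, by omega⟩, ?_, ?_⟩
      · rw [h, Sset_left b hi', Finset.mem_insert, not_or]
        exact ⟨(left_ne_right hbi hi').symm, right_notMem_blockPrefix hbi hi'⟩
      · rw [h, Sset_left b hi', blockPrefix_succ b hi', Finset.insert_comm]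
    · refine ⟨b ⟨2 * i, by omega⟩, ?_, ?_⟩
      · rw [h, Sset_right b hi', Finset.mem_insert, not_or]
        exact ⟨left_ne_right hbi hi', left_notMem_blockPrefix hbi hi'⟩
      · rw [h, Sset_right b hi', blockPrefix_succ b hi']
  have hao : blockPrefix k a (i + 1) =
      insert (a ⟨2 * i + 1, by omega⟩) (Sset k a ⟨2 * i, by omega⟩) := by
    rw [Sset_left a hi', blockPrefix_succ a hi', Finset.insert_comm]
  have har : a ⟨2 * i + 1, by omega⟩ ∉ Sset k a ⟨2 * i, by omega⟩ := by
    rw [Sset_left a hi', Finset.mem_insert, not_or]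
    exact ⟨(left_ne_right hai hi').symm, right_notMem_blockPrefix hai hi'⟩
  have hle : o ≤ a ⟨2 * i + 1, by omega⟩ := by
    have hmem : o ∈ blockPrefix k b (i + 1) := hbo ▸ Finset.mem_insert_self _ _
    have hmem' : o ∈ Sset k a ⟨2 * (i + 1), by omega⟩ := by
      rcases hab (i + 1) hi with h | h
      · rw [h, Sset_left b hi]
        exact Finset.mem_insert_of_mem hmem
      · rw [h, Sset_right b hi]
        exact Finset.mem_insert_of_mem hmem
    rw [Sset_left a hi, hao, Finset.mem_insert, Finset.mem_insert] at hmem'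
    rcases hmem' with h | h | h
    · rw [h]
      exact (ha.2 i hi).le
    · exact h.le
    · exact absurd h ho
  rw [hbo, hao, Finset.sum_insert ho, Finset.sum_insert har]
  refine ⟨by omega, fun h => ?_⟩
  have ho_eq : o = a ⟨2 * i + 1, by omega⟩ := by omega
  rw [ho_eq]

theorem Subordinate.prefixWeight_lt {k : ℕ} {I : Finset ℕ} (hI : I.card = 2 * k)
    {a b : PermOn k I} (ha : IsAlt k a.1) (hb : IsAlt k b.1) (hab : Subordinate k a.1 b.1)
    (hne : b ≠ a) : prefixWeight k b.1 < prefixWeight k a.1 := by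
  have hlast : blockPrefix k a.1 k = blockPrefix k b.1 k := by
    rw [blockPrefix_self hI, blockPrefix_self hI]
  have hle : ∀ i ∈ Finset.range k, ∑ v ∈ blockPrefix k b.1 (i + 1), v ≤
      ∑ v ∈ blockPrefix k a.1 (i + 1), v := by
    intro i hi
    rw [Finset.mem_range] at hi
    rcases (by omega : i + 1 < k ∨ i + 1 = k) with h | h
    · exact (hab.sum_blockPrefix_le ha a.2.1 b.2.1 h).1
    · rw [h, hlast]
  refine lt_of_le_of_ne (Finset.sum_le_sum hle) fun heq => hne ?_
  have heq' := (Finset.sum_eq_sum_iff_of_le hle).1 heq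
  refine (Subtype.ext (ha.eq_of_blockPrefix_eq hb a.2.1 b.2.1 ?_)).symm
  intro i hi
  rcases i with _ | i
  · simp [blockPrefix]
  · rcases (by omega : i + 1 < k ∨ i + 1 = k) with h | h
    · exact (hab.sum_blockPrefix_le ha a.2.1 b.2.1 h).2 (heq' i (Finset.mem_range.2 (by omega)))
    · rw [h, hlast]

/-- Prepend a vertex to a walk. -/
def consWalk {P : Type*} (a : P) (w : (m : ℕ) × (Fin (m + 1) → P)) :
    (m : ℕ) × (Fin (m + 1) → P) :=
  ⟨w.1 + 1, Fin.cons a w.2⟩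

theorem consWalk_injective {P : Type*} (a : P) : Function.Injective (consWalk a) := by
  rintro ⟨m, v⟩ ⟨n, w⟩ h
  rw [consWalk, consWalk, Sigma.mk.injEq] at h
  obtain ⟨h₁, h₂⟩ := h
  simp only [Nat.add_right_cancel_iff] at h₁
  subst h₁
  have hvw : v = w := Fin.cons_right_injective (α := fun _ => P) a (heq_eq_eq _ _ ▸ h₂)
  rw [hvw]

theorem wtW_consWalk {k : ℕ} {I : Finset ℕ} (a : PermOn k I)
    (w : (m : ℕ) × (Fin (m + 1) → PermOn k I)) :
    wtW k I (consWalk a w) = sI k I a (w.2 0) + wtW k I w :=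
  Fin.sum_univ_succ (n := w.1) _

theorem Walks_eq_union {k : ℕ} {I : Finset ℕ} {a : PermOn k I} (ha : IsAlt k a.1)
    (x : PermOn k I) :
    Walks k I a x =
      {w | w = consWalk a ⟨0, fun _ => x⟩ ∧ Subordinate k a.1 x.1} ∪
      ⋃ b ∈ {b : PermOn k I | IsAlt k b.1 ∧ Subordinate k a.1 b.1 ∧ b ≠ a},
        consWalk a '' Walks k I b x := by
  ext ⟨m, v⟩
  simp only [Set.mem_union, Set.mem_iUnion, Set.mem_ofPred_eq, Set.mem_image, exists_prop]
  constructor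
  · rintro ⟨hm, h0, hl, hs, hn⟩
    simp only at hm h0 hl hs hn
    obtain ⟨m, rfl⟩ : ∃ n, m = n + 1 := ⟨m - 1, by omega⟩
    have hv : (⟨m + 1, v⟩ : (m : ℕ) × (Fin (m + 1) → PermOn k I)) =
        consWalk a ⟨m, Fin.tail v⟩ := by
      rw [consWalk, ← h0]
      simp only [Fin.cons_self_tail]
    rcases m with _ | m
    · left
      have htail : (Fin.tail v : Fin 1 → PermOn k I) = fun _ => x := by
        funext t
        rw [← hl, Subsingleton.elim t (Fin.last 0)]
        rfl
      refine ⟨by rw [hv, htail], ?_⟩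
      rw [← h0, ← hl]
      exact (hs 0 (by omega)).2
    · right
      refine ⟨v 1, ⟨(hs 1 (by omega)).1, ?_, ?_⟩, ⟨m + 1, Fin.tail v⟩, ⟨?_, ?_, ?_, ?_, ?_⟩, hv.symm⟩
      · rw [← h0]
        exact (hs 0 (by omega)).2
      · rw [← h0]
        exact (hn 0 (by omega)).symm
      · simp
      · rfl
      · exact hl
      · exact fun j hj => hs (j + 1) (Nat.succ_lt_succ hj)
      · exact fun j hj => hn (j + 1) (Nat.succ_lt_succ hj)
  · rintro (⟨hw, hsub⟩ | ⟨b, ⟨hb, hab, hne⟩, w, ⟨hm, h0, hl, hs, hn⟩, hw⟩)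
    · rw [hw]
      refine ⟨le_rfl, rfl, rfl, ?_, ?_⟩
      · intro j hj
        obtain rfl : j = 0 := Nat.lt_one_iff.1 hj
        exact ⟨ha, hsub⟩
      · intro j hj
        exact absurd (show j + 1 < 1 from hj) (by omega)
    · rw [← hw]
      obtain ⟨m, w⟩ := w
      refine ⟨Nat.succ_pos _, rfl, hl, ?_, ?_⟩
      · intro j hj
        rcases j with _ | j
        · refine ⟨ha, ?_⟩
          have h0' : w 0 = b := h0
          change Subordinate k a.1 (w 0).1
          exact h0' ▸ hab
        · exact hs j (Nat.lt_of_succ_lt_succ hj)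
      · intro j hj
        rcases j with _ | j
        · change a ≠ w 0
          exact fun h => hne (h0.symm.trans h.symm)
        · exact hn j (Nat.lt_of_succ_lt_succ hj)

theorem Walks_finite {k : ℕ} {I : Finset ℕ} (hI : I.card = 2 * k) (x : PermOn k I) :
    ∀ a : PermOn k I, IsAlt k a.1 → (Walks k I a x).Finite := by
  intro a
  induction hn : prefixWeight k a.1 using Nat.strong_induction_on generalizing a with
  | _ n ih =>
    intro ha
    rw [Walks_eq_union ha]
    refine Set.Finite.union ?_ (Set.Finite.biUnion (Set.toFinite _) fun b hb => ?_)
    · exact (Set.finite_singleton (consWalk a ⟨0, fun _ => x⟩)).subset fun w hw => hw.1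
    · exact (ih _ (hn ▸ hb.2.1.prefixWeight_lt hI ha hb.1 hb.2.2) b rfl hb.1).image _

theorem TCoef_eq_sub {k : ℕ} {I : Finset ℕ} (hI : I.card = 2 * k) (x : PermOn k I)
    {a : PermOn k I} (ha : IsAlt k a.1) :
    TCoef k I a x = subSign k a.1 x.1 -
      ∑ᶠ b ∈ {b : PermOn k I | IsAlt k b.1 ∧ Subordinate k a.1 b.1 ∧ b ≠ a},
        subSign k a.1 b.1 * TCoef k I b x := by
  have hdisj : Disjoint {w | w = consWalk a ⟨0, fun _ => x⟩ ∧ Subordinate k a.1 x.1}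
      (⋃ b ∈ {b : PermOn k I | IsAlt k b.1 ∧ Subordinate k a.1 b.1 ∧ b ≠ a},
        consWalk a '' Walks k I b x) := by
    rw [Set.disjoint_left]
    rintro _ ⟨rfl, -⟩ h
    simp only [Set.mem_iUnion, Set.mem_image] at h
    obtain ⟨b, _, w, hw, he⟩ := h
    have h₁ := hw.1
    rw [consWalk_injective a he] at h₁
    exact absurd h₁ (by simp)
  have hfin : {w : (m : ℕ) × (Fin (m + 1) → PermOn k I) |
      w = consWalk a ⟨0, fun _ => x⟩ ∧ Subordinate k a.1 x.1}.Finite :=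
    (Set.finite_singleton (consWalk a ⟨0, fun _ => x⟩)).subset fun w hw => hw.1
  have hfin' : ∀ b ∈ {b : PermOn k I | IsAlt k b.1 ∧ Subordinate k a.1 b.1 ∧ b ≠ a},
      (consWalk a '' Walks k I b x).Finite :=
    fun b hb => (Walks_finite hI x b hb.1).image _
  have hpair : {b : PermOn k I | IsAlt k b.1 ∧ Subordinate k a.1 b.1 ∧ b ≠ a}.PairwiseDisjoint
      fun b => consWalk a '' Walks k I b x := by
    intro b _ c _ hbc
    rw [Function.onFun, Set.disjoint_left]
    rintro _ ⟨w, hw, rfl⟩ ⟨w', hw', he⟩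
    obtain rfl := consWalk_injective a he
    exact hbc (hw.2.1.symm.trans hw'.2.1)
  have hone : ∑ᶠ p ∈ {w : (m : ℕ) × (Fin (m + 1) → PermOn k I) |
      w = consWalk a ⟨0, fun _ => x⟩ ∧ Subordinate k a.1 x.1}, (-1 : ℚ) ^ wtW k I p =
      -subSign k a.1 x.1 := by
    by_cases hsub : Subordinate k a.1 x.1
    · simp only [hsub, and_true, Set.ofPred_eq_eq_singleton, finsum_mem_singleton]
      rw [wtW_consWalk, ← neg_one_pow_sI hI hsub]
      simp [wtW]
    · simp only [hsub, and_false, Set.ofPred_false, finsum_mem_empty]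
      rw [not_imp_comm.1 subordinate_of_subSign_ne_zero hsub, neg_zero]
  unfold TCoef
  rw [Walks_eq_union ha, finsum_mem_union hdisj hfin (Set.Finite.biUnion (Set.toFinite _) hfin'),
    finsum_mem_biUnion hpair (Set.toFinite _) hfin', hone, neg_add, neg_neg, sub_eq_add_neg]
  congr 2
  refine finsum_mem_congr rfl fun b hb => ?_
  rw [finsum_mem_image (consWalk_injective a).injOn, mul_neg, ← neg_mul,
    mul_finsum_mem]
  refine finsum_mem_congr rfl fun w hw => ?_
  rw [wtW_consWalk, pow_add, hw.2.1, neg_one_pow_sI hI hb.2.1]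

theorem finsum_subSign_mul_TCoef {k : ℕ} {I : Finset ℕ} (hI : I.card = 2 * k) (x : PermOn k I)
    {a : PermOn k I} (ha : IsAlt k a.1) :
    ∑ᶠ b ∈ {b : PermOn k I | IsAlt k b.1}, subSign k a.1 b.1 * TCoef k I b x =
      subSign k a.1 x.1 := by
  have hset : {b : PermOn k I | IsAlt k b.1} = insert a {b : PermOn k I | IsAlt k b.1 ∧ b ≠ a} := by
    ext b
    by_cases hb : b = a <;> simp [hb, ha]
  rw [hset, finsum_mem_insert _ (by simp) (Set.toFinite _), subSign_self a.2.1, one_mul,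
    TCoef_eq_sub hI x ha, sub_add, sub_eq_self, sub_eq_zero]
  refine finsum_mem_inter_support_eq _ _ _ ?_
  ext b
  simp only [Set.mem_inter_iff, Set.mem_ofPred_eq, Function.mem_support]
  constructor
  · rintro ⟨⟨h₁, -, h₂⟩, h₃⟩
    exact ⟨⟨h₁, h₂⟩, h₃⟩
  · rintro ⟨⟨h₁, h₂⟩, h₃⟩
    exact ⟨⟨h₁, subordinate_of_subSign_ne_zero (left_ne_zero_of_mul h₃), h₂⟩, h₃⟩

theorem eq_zero_of_sum_subSign_eq_zero {k : ℕ} {I : Finset ℕ} (hI : I.card = 2 * k)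
    (c : PermOn k I →₀ ℚ) (hc : ∀ b, c b ≠ 0 → IsAlt k b.1)
    (h : ∀ a : PermOn k I, IsAlt k a.1 → c.sum (fun b r => r * subSign k a.1 b.1) = 0) : c = 0 := by
  have key : ∀ a : PermOn k I, c a = 0 := by
    intro a
    induction hn : prefixWeight k a.1 using Nat.strong_induction_on generalizing a with
    | _ n ih =>
      by_contra hca
      have ha := hc a hca
      have hsum := h a ha
      rw [Finsupp.sum, Finset.sum_eq_single a, subSign_self a.2.1, mul_one] at hsum
      · exact hca hsum
      · intro b hb hba
        have hcb := Finsupp.mem_support_iff.1 hb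
        by_contra hne
        have hsub := subordinate_of_subSign_ne_zero (right_ne_zero_of_mul hne)
        exact hcb (ih _ (hn ▸ hsub.prefixWeight_lt hI ha (hc b hcb) hba) b rfl)
      · intro h'
        exact absurd (Finsupp.mem_support_iff.2 hca) h'
  exact Finsupp.ext key

theorem set4_of_outside {k : ℕ} (x : Fin (2 * k) → ℕ) {i : ℕ} (p q r s : ℕ) {t : Fin (2 * k)}
    (ht : (t : ℕ) < 2 * i ∨ 2 * (i + 2) ≤ (t : ℕ)) : set4 k x i p q r s t = x t := by
  rw [set4, if_neg (by omega), if_neg (by omega), if_neg (by omega), if_neg (by omega)]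

theorem set4_values {k : ℕ} (x : Fin (2 * k) → ℕ) {i : ℕ} (h : i + 1 < k) (p q r s : ℕ) :
    set4 k x i p q r s ⟨2 * i, by omega⟩ = p ∧
    set4 k x i p q r s ⟨2 * i + 1, by omega⟩ = q ∧
    set4 k x i p q r s ⟨2 * (i + 1), by omega⟩ = r ∧
    set4 k x i p q r s ⟨2 * (i + 1) + 1, by omega⟩ = s := by
  refine ⟨by simp [set4], by simp [set4], by simp [set4, Nat.mul_add], ?_⟩
  simp only [set4]
  rw [if_neg (by omega), if_neg (by omega), if_neg (by omega), if_pos (by omega)]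

theorem subSign_set4 {k : ℕ} (a x : Fin (2 * k) → ℕ) {i : ℕ} (h : i + 1 < k) (p q r s : ℕ)
    (hset : blockPrefix k x (i + 2) =
      insert p (insert q (insert r (insert s (blockPrefix k x i))))) :
    subSign k a (set4 k x i p q r s) =
      (∏ j ∈ (Finset.univ.erase (⟨i, by omega⟩ : Fin k)).erase ⟨i + 1, h⟩,
        subFactor k (Sset k a ⟨2 * j, by omega⟩) x j) *
      (((if Sset k a ⟨2 * i, by omega⟩ = insert p (blockPrefix k x i) then 1 else 0) -
        (if Sset k a ⟨2 * i, by omega⟩ = insert q (blockPrefix k x i) then 1 else 0)) *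
      ((if Sset k a ⟨2 * (i + 1), by omega⟩ =
          insert p (insert q (insert r (blockPrefix k x i))) then 1 else 0) -
        (if Sset k a ⟨2 * (i + 1), by omega⟩ =
          insert p (insert q (insert s (blockPrefix k x i))) then 1 else 0))) := by
  obtain ⟨hp, hq, hr, hs⟩ := set4_values x h p q r s
  have hout : ∀ t : Fin (2 * k), (t : ℕ) < 2 * i ∨ 2 * (i + 2) ≤ (t : ℕ) →
    set4 k x i p q r s t = x t := fun t ht => set4_of_outside x p q r s ht
  generalize set4 k x i p q r s = y at *
  have hlow : ∀ j ≤ i, blockPrefix k y j = blockPrefix k x j := fun j hj =>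
    blockPrefix_congr_of_lt fun t ht => hout t (by omega)
  have hmid : blockPrefix k y (i + 1) = insert p (insert q (blockPrefix k x i)) := by
    rw [blockPrefix_succ y (by omega), hlow i le_rfl, hp, hq]
  have hhigh : ∀ j, i + 2 ≤ j → j ≤ k → blockPrefix k y j = blockPrefix k x j := by
    refine blockPrefix_congr ?_ fun t ht => hout t (Or.inr ht)
    rw [hset, blockPrefix_succ y h, hmid, hr, hs]
    ext v
    simp only [Finset.mem_insert]
    tauto
  have hne : (⟨i + 1, h⟩ : Fin k) ≠ ⟨i, by omega⟩ := by simp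
  unfold subSign
  rw [← Finset.mul_prod_erase _ _ (Finset.mem_univ (⟨i, by omega⟩ : Fin k)),
    ← Finset.mul_prod_erase _ _ (Finset.mem_erase.2 ⟨hne, Finset.mem_univ (⟨i + 1, h⟩ : Fin k)⟩),
    ← mul_assoc, mul_comm]
  congr 1
  · refine Finset.prod_congr rfl fun j hj => ?_
    simp only [Finset.mem_erase, ne_eq, Fin.ext_iff, Finset.mem_univ, and_true] at hj
    have hj' : (j : ℕ) < i ∨ i + 2 ≤ (j : ℕ) := by omega
    refine subFactor_congr _ ?_ (hout _ ?_) (hout _ ?_)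
    · rcases hj' with h' | h'
      · exact hlow j h'.le
      · exact hhigh j h' j.2.le
    all_goals simp only; omega
  · rw [subFactor_eq, subFactor_eq]
    simp only [hlow i le_rfl, hmid, hp, hq, hr, hs]
    rw [Finset.insert_comm r p, Finset.insert_comm r q, Finset.insert_comm s p,
      Finset.insert_comm s q]

theorem set4_self {k : ℕ} (x : Fin (2 * k) → ℕ) {i : ℕ} (h : i + 1 < k) :
    set4 k x i (x ⟨2 * i, by omega⟩) (x ⟨2 * i + 1, by omega⟩) (x ⟨2 * i + 2, by omega⟩)
      (x ⟨2 * i + 3, by omega⟩) = x := by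
  funext t
  unfold set4
  split_ifs with h₁ h₂ h₃ h₄
  · exact congrArg x (Fin.ext h₁.symm)
  · exact congrArg x (Fin.ext h₂.symm)
  · exact congrArg x (Fin.ext h₃.symm)
  · exact congrArg x (Fin.ext h₄.symm)
  · rfl

theorem blockPrefix_add_two {k : ℕ} (x : Fin (2 * k) → ℕ) {i : ℕ} (h : i + 1 < k) :
    blockPrefix k x (i + 2) = insert (x ⟨2 * i, by omega⟩) (insert (x ⟨2 * i + 1, by omega⟩)
      (insert (x ⟨2 * i + 2, by omega⟩) (insert (x ⟨2 * i + 3, by omega⟩)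
        (blockPrefix k x i)))) := by
  rw [blockPrefix_succ x h, blockPrefix_succ x (by omega)]
  ext v
  simp only [Finset.mem_insert, Nat.mul_add, Nat.add_assoc, Nat.reduceMul, Nat.reduceAdd]
  tauto

theorem subSign_garnir {k : ℕ} (α x : Fin (2 * k) → ℕ) {i : ℕ} (h : i + 1 < k) {a b c d : ℕ}
    (ha : x ⟨2 * i, by omega⟩ = a) (hb : x ⟨2 * i + 1, by omega⟩ = b)
    (hc : x ⟨2 * i + 2, by omega⟩ = c) (hd : x ⟨2 * i + 3, by omega⟩ = d) :
    subSign k α x - subSign k α (set4 k x i a c b d) + subSign k α (set4 k x i a d b c) +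
      subSign k α (set4 k x i b c a d) - subSign k α (set4 k x i b d a c) +
      subSign k α (set4 k x i c d a b) = 0 := by
  have hset := blockPrefix_add_two x h
  have hx := set4_self x h
  rw [ha, hb, hc, hd] at hset hx
  nth_rw 1 [← hx]
  rw [subSign_set4 α x h a b c d hset]
  rw [subSign_set4 α x h a c b d, subSign_set4 α x h a d b c, subSign_set4 α x h b c a d,
    subSign_set4 α x h b d a c, subSign_set4 α x h c d a b]
  · generalize blockPrefix k x i = P
    rw [Finset.insert_comm c b P, Finset.insert_comm d b P, Finset.insert_comm d c P,
      Finset.insert_comm c a P, Finset.insert_comm d a P, Finset.insert_comm b a (insert c P),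
      Finset.insert_comm b a (insert d P), Finset.insert_comm c a (insert d P),
      Finset.insert_comm c b (insert d P)]
    ring
  all_goals
    rw [hset]
    ext v
    simp only [Finset.mem_insert]
    tauto

/-- The linear map sending `v` to its `subSign`-pairing with `a`. -/
noncomputable def signPairing (k : ℕ) (I : Finset ℕ) (a : Fin (2 * k) → ℕ) :
    (PermOn k I →₀ ℚ) →ₗ[ℚ] ℚ :=
  Finsupp.linearCombination ℚ fun x : PermOn k I => subSign k a x.1

theorem MI_le_ker_signPairing (k : ℕ) (I : Finset ℕ) (a : Fin (2 * k) → ℕ) :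
    MI k I ≤ LinearMap.ker (signPairing k I a) := by
  refine Submodule.span_le.2 ?_
  rintro v (⟨x, x', i, h, hx, rfl⟩ | ⟨x, y₁, y₂, y₃, y₄, y₅, i, h, ⟨h₁, h₂, h₃, h₄, h₅⟩, rfl⟩)
  · simp [signPairing, hx, subSign_comp_blockSwap a x.1 h]
  · simp only [signPairing, SetLike.mem_coe, LinearMap.mem_ker, map_add, map_sub,
      Finsupp.linearCombination_single, one_smul, h₁, h₂, h₃, h₄, h₅]
    exact subSign_garnir a x.1 h rfl rfl rfl rfl

/-- A weighted sum of values that decreases under straightening. -/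
def straighteningWeight (k : ℕ) (x : Fin (2 * k) → ℕ) : ℕ :=
  ∑ i : Fin k, ((2 * i + 1) * x ⟨2 * i, by omega⟩ + 2 * i * x ⟨2 * i + 1, by omega⟩)

theorem straighteningWeight_swap_lt {k : ℕ} {x : Fin (2 * k) → ℕ} {i : ℕ} (h : i < k)
    (hlt : x ⟨2 * i + 1, by omega⟩ < x ⟨2 * i, by omega⟩) :
    straighteningWeight k
      (x ∘ Equiv.swap (⟨2 * i, by omega⟩ : Fin (2 * k)) ⟨2 * i + 1, by omega⟩) <
      straighteningWeight k x := by
  unfold straighteningWeight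
  rw [← Finset.add_sum_erase _ _ (Finset.mem_univ (⟨i, h⟩ : Fin k)),
    ← Finset.add_sum_erase Finset.univ (fun j : Fin k => (2 * (j : ℕ) + 1) * x ⟨2 * j, _⟩ + _)
      (Finset.mem_univ (⟨i, h⟩ : Fin k))]
  refine add_lt_add_of_lt_of_le ?_ (Finset.sum_le_sum fun j hj => ?_)
  · simp only [Function.comp, Equiv.swap_apply_left, Equiv.swap_apply_right]
    nlinarith
  · have hji : (j : ℕ) ≠ i := fun hc => (Finset.mem_erase.1 hj).1 (Fin.ext hc)
    rw [comp_blockSwap_of_ne x h, comp_blockSwap_of_ne x h]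
    all_goals simp only; omega

theorem straighteningWeight_set4_lt {k : ℕ} {x : Fin (2 * k) → ℕ} {i : ℕ} (h : i + 1 < k)
    {p q r s : ℕ}
    (hlt : (2 * i + 1) * p + 2 * i * q + (2 * i + 3) * r + (2 * i + 2) * s <
      (2 * i + 1) * x ⟨2 * i, by omega⟩ + 2 * i * x ⟨2 * i + 1, by omega⟩ +
        (2 * i + 3) * x ⟨2 * i + 2, by omega⟩ + (2 * i + 2) * x ⟨2 * i + 3, by omega⟩) :
    straighteningWeight k (set4 k x i p q r s) < straighteningWeight k x := by
  obtain ⟨hp, hq, hr, hs⟩ := set4_values x h p q r s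
  have hout : ∀ t : Fin (2 * k), (t : ℕ) < 2 * i ∨ 2 * (i + 2) ≤ (t : ℕ) →
    set4 k x i p q r s t = x t := fun t ht => set4_of_outside x p q r s ht
  generalize set4 k x i p q r s = y at *
  have hne : (⟨i + 1, h⟩ : Fin k) ≠ ⟨i, by omega⟩ := by simp
  have hsplit : ∀ z : Fin (2 * k) → ℕ, straighteningWeight k z =
      ((2 * i + 1) * z ⟨2 * i, by omega⟩ + 2 * i * z ⟨2 * i + 1, by omega⟩ +
        ((2 * (i + 1) + 1) * z ⟨2 * (i + 1), by omega⟩ +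
          2 * (i + 1) * z ⟨2 * (i + 1) + 1, by omega⟩)) +
      ∑ j ∈ (Finset.univ.erase (⟨i, by omega⟩ : Fin k)).erase ⟨i + 1, h⟩,
        ((2 * (j : ℕ) + 1) * z ⟨2 * j, by omega⟩ + 2 * j * z ⟨2 * j + 1, by omega⟩) := by
    intro z
    unfold straighteningWeight
    rw [← Finset.add_sum_erase _ _ (Finset.mem_univ (⟨i, by omega⟩ : Fin k)),
      ← Finset.add_sum_erase _ _ (Finset.mem_erase.2 ⟨hne, Finset.mem_univ (⟨i + 1, h⟩ : Fin k)⟩)]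
    exact (add_assoc _ _ _).symm
  rw [hsplit, hsplit]
  refine add_lt_add_of_lt_of_le ?_ (Finset.sum_le_sum fun j hj => ?_)
  · rw [hp, hq, hr, hs]
    simp only [Nat.mul_add, Nat.add_assoc, Nat.reduceMul, Nat.reduceAdd] at hlt ⊢
    omega
  · simp only [Finset.mem_erase, ne_eq, Fin.ext_iff, Finset.mem_univ, and_true] at hj
    rw [hout, hout]
    all_goals simp only; omega

theorem exists_set4 {k : ℕ} {I : Finset ℕ} (x : PermOn k I) {i : ℕ} (h : i + 1 < k)
    (m₀ m₁ m₂ m₃ : Fin 4) (hm : [m₀, m₁, m₂, m₃].Nodup) :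
    ∃ y : PermOn k I, y.1 = set4 k x.1 i
      (x.1 ⟨2 * i + m₀, by omega⟩) (x.1 ⟨2 * i + m₁, by omega⟩)
      (x.1 ⟨2 * i + m₂, by omega⟩) (x.1 ⟨2 * i + m₃, by omega⟩) := by
  simp only [List.nodup_cons, List.mem_cons, List.not_mem_nil, or_false, not_or, Fin.ext_iff] at hm
  suffices hy : Function.Injective (set4 k x.1 i
      (x.1 ⟨2 * i + m₀, by omega⟩) (x.1 ⟨2 * i + m₁, by omega⟩)
      (x.1 ⟨2 * i + m₂, by omega⟩) (x.1 ⟨2 * i + m₃, by omega⟩)) ∧ ∀ t, set4 k x.1 i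
      (x.1 ⟨2 * i + m₀, by omega⟩) (x.1 ⟨2 * i + m₁, by omega⟩)
      (x.1 ⟨2 * i + m₂, by omega⟩) (x.1 ⟨2 * i + m₃, by omega⟩) t ∈ I from ⟨⟨_, hy⟩, rfl⟩
  constructor
  · intro s t hst
    unfold set4 at hst
    split_ifs at hst <;>
    · simp only [x.2.1.eq_iff, Fin.ext_iff] at hst ⊢
      omega
  · intro t
    unfold set4
    split_ifs <;> exact x.2.2 _

theorem single_mem_of_swap {k : ℕ} {I : Finset ℕ} {N : Submodule ℚ (PermOn k I →₀ ℚ)}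
    (hN : MI k I ≤ N) {x x' : PermOn k I} {i : ℕ} (h : i < k)
    (hx : x'.1 = x.1 ∘ Equiv.swap (⟨2 * i, by omega⟩ : Fin (2 * k)) ⟨2 * i + 1, by omega⟩)
    (hx' : Finsupp.single x' (1 : ℚ) ∈ N) : Finsupp.single x (1 : ℚ) ∈ N :=
  (N.add_mem_iff_left hx').1
    (hN (Submodule.subset_span (Or.inl ⟨x, x', i, h, hx, rfl⟩)))

theorem single_mem_of_garnir {k : ℕ} {I : Finset ℕ} {N : Submodule ℚ (PermOn k I →₀ ℚ)}
    (hN : MI k I ≤ N) {x : PermOn k I} {i : ℕ} (h : i + 1 < k)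
    (hab : x.1 ⟨2 * i, by omega⟩ < x.1 ⟨2 * i + 1, by omega⟩)
    (hbc : x.1 ⟨2 * i + 1, by omega⟩ < x.1 ⟨2 * i + 2, by omega⟩)
    (hcd : x.1 ⟨2 * i + 2, by omega⟩ < x.1 ⟨2 * i + 3, by omega⟩)
    (hy : ∀ y : PermOn k I, straighteningWeight k y.1 < straighteningWeight k x.1 →
      Finsupp.single y (1 : ℚ) ∈ N) : Finsupp.single x (1 : ℚ) ∈ N := by
  obtain ⟨y₁, h₁⟩ := exists_set4 x h 0 2 1 3 (by decide)
  obtain ⟨y₂, h₂⟩ := exists_set4 x h 0 3 1 2 (by decide)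
  obtain ⟨y₃, h₃⟩ := exists_set4 x h 1 2 0 3 (by decide)
  obtain ⟨y₄, h₄⟩ := exists_set4 x h 1 3 0 2 (by decide)
  obtain ⟨y₅, h₅⟩ := exists_set4 x h 2 3 0 1 (by decide)
  simp only [Fin.val_zero, Fin.val_one, Fin.val_two, add_zero,
    show ((3 : Fin 4) : ℕ) = 3 from rfl] at h₁ h₂ h₃ h₄ h₅
  have hg := hN (Submodule.subset_span
    (Or.inr ⟨x, y₁, y₂, y₃, y₄, y₅, i, h, ⟨h₁, h₂, h₃, h₄, h₅⟩, rfl⟩))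
  have hm₁ := hy y₁ (h₁ ▸ straighteningWeight_set4_lt h (by nlinarith))
  have hm₂ := hy y₂ (h₂ ▸ straighteningWeight_set4_lt h (by nlinarith))
  have hm₃ := hy y₃ (h₃ ▸ straighteningWeight_set4_lt h (by nlinarith))
  have hm₄ := hy y₄ (h₄ ▸ straighteningWeight_set4_lt h (by nlinarith))
  have hm₅ := hy y₅ (h₅ ▸ straighteningWeight_set4_lt h (by nlinarith))
  rwa [N.add_mem_iff_left hm₅, N.sub_mem_iff_left hm₄, N.add_mem_iff_left hm₃,
    N.add_mem_iff_left hm₂, N.sub_mem_iff_left hm₁] at hg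

/-- Straightening: alternating permutations span modulo `MI k I`. -/
theorem single_mem_sup_supported (k : ℕ) (I : Finset ℕ) (x : PermOn k I) :
    Finsupp.single x (1 : ℚ) ∈
      MI k I ⊔ Finsupp.supported ℚ ℚ {a : PermOn k I | IsAlt k a.1} := by
  induction hn : straighteningWeight k x.1 using Nat.strong_induction_on generalizing x with
  | _ n ih =>
    subst hn
    have hy : ∀ y : PermOn k I, straighteningWeight k y.1 < straighteningWeight k x.1 →
        Finsupp.single y (1 : ℚ) ∈
          MI k I ⊔ Finsupp.supported ℚ ℚ {a : PermOn k I | IsAlt k a.1} :=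
      fun y hlt => ih _ hlt y rfl
    by_cases h₁ : ∀ i : ℕ, ∀ h : i < k, x.1 ⟨2 * i, by omega⟩ < x.1 ⟨2 * i + 1, by omega⟩
    · by_cases h₂ : ∀ i : ℕ, ∀ h : i + 1 < k,
          x.1 ⟨2 * i + 2, by omega⟩ < x.1 ⟨2 * i + 1, by omega⟩
      · exact Submodule.mem_sup_right (Finsupp.single_mem_supported ℚ 1 ⟨h₁, h₂⟩)
      · push Not at h₂
        obtain ⟨i, h, hle⟩ := h₂
        refine single_mem_of_garnir le_sup_left h (h₁ i (by omega)) ?_ (h₁ (i + 1) h) hy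
        refine lt_of_le_of_ne hle fun heq => ?_
        have := congrArg Fin.val (x.2.1 heq)
        simp only at this
        omega
    · push Not at h₁
      obtain ⟨i, h, hle⟩ := h₁
      have hlt := lt_of_le_of_ne hle (left_ne_right x.2.1 h).symm
      exact single_mem_of_swap le_sup_left h
        (x' := ⟨_, x.2.1.comp (Equiv.injective _), fun t => x.2.2 _⟩) rfl
        (hy _ (straighteningWeight_swap_lt h hlt))

/-- For every `x ∈ Perm_I`, `x − Σ_{α ∈ Alt_I} TC^α_x · α ∈ M_I`. -/
theorem statement10 (k : ℕ) (hk : 1 ≤ k) (I : Finset ℕ) (hI : I.card = 2 * k)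
    (x : PermOn k I) :
    Finsupp.single x (1 : ℚ) -
        ∑ᶠ α ∈ {a : PermOn k I | IsAlt k a.1}, TCoef k I α x • Finsupp.single α (1 : ℚ)
      ∈ MI k I := by
  set C : PermOn k I →₀ ℚ :=
    ∑ᶠ α ∈ {a : PermOn k I | IsAlt k a.1}, TCoef k I α x • Finsupp.single α (1 : ℚ)
  have hCmem : C ∈ Finsupp.supported ℚ ℚ {a : PermOn k I | IsAlt k a.1} :=
    finsum_mem_induction (· ∈ Finsupp.supported ℚ ℚ {a : PermOn k I | IsAlt k a.1})
      (Submodule.zero_mem _) (fun _ _ => Submodule.add_mem _)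
      fun α hα => Submodule.smul_mem _ _ (Finsupp.single_mem_supported ℚ 1 hα)
  have hpair : ∀ a : PermOn k I, IsAlt k a.1 →
      signPairing k I a.1 (Finsupp.single x 1 - C) = 0 := by
    intro a ha
    have hmap : signPairing k I a.1 C = ∑ᶠ α ∈ {a : PermOn k I | IsAlt k a.1},
        signPairing k I a.1 (TCoef k I α x • Finsupp.single α (1 : ℚ)) :=
      (signPairing k I a.1).toAddMonoidHom.map_finsum_mem _ (Set.toFinite _)
    rw [map_sub, sub_eq_zero, hmap]
    simp only [signPairing, Finsupp.linearCombination_single, one_smul]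
    rw [← finsum_subSign_mul_TCoef hI x ha]
    refine finsum_mem_congr rfl fun b _ => ?_
    simp [mul_comm]
  obtain ⟨m, hm, s, hs, hms⟩ := Submodule.mem_sup.1
    (Submodule.sub_mem _ (single_mem_sup_supported k I x) (Submodule.mem_sup_right hCmem))
  have hs0 : s = 0 := by
    refine eq_zero_of_sum_subSign_eq_zero hI s
      (fun b hb => (Finsupp.mem_supported ℚ s).1 hs (Finsupp.mem_support_iff.2 hb)) fun a ha => ?_
    have h := hpair a ha
    rw [← hms, map_add, LinearMap.mem_ker.1 (MI_le_ker_signPairing k I a.1 hm), zero_add] at h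
    exact h
  rw [← hms, hs0, add_zero]
  exact hm
end

section
/- Let x ∈ Perm_I and 1 ≤ i ≤ k−1 satisfy x_{2i−1} < x_{2i} < x_{2i+1} < x_{2i+2}. Writing (a, b, c, d) = (x_{2i−1}, x_{2i}, x_{2i+1}, x_{2i+2}), each of the five permutations x(ac/bd), x(ad/bc), x(bc/ad), x(bd/ac), x(cd/ab) is strictly smaller than x in the order ≺. -/
/-- Rewriting blocks `i` and `i + 1` so that the sum of block `i + 1` drops yields a
`≺`-smaller tuple, since all later blocks are unchanged. -/
theorem permLt_set4 (k : ℕ) (x : Fin (2 * k) → ℕ) (i : ℕ) (hi : i + 1 < k) (p q r s : ℕ)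
    (h : r + s < x ⟨2 * i + 2, by omega⟩ + x ⟨2 * i + 3, by omega⟩) :
    PermLt k (set4 k x i p q r s) x := by
  have block_lt : ∀ (m : ℕ) (hm : m < k), m = i + 1 →
      blockSum k (set4 k x i p q r s) m hm < blockSum k x m hm := by
    rintro m hm rfl
    have hp : 2 * i + 2 + 1 ≠ 2 * i := by omega
    simpa [blockSum, set4, Nat.mul_add, hp] using h
  have block_eq : ∀ (m : ℕ) (hm : m < k), i + 1 < m →
      blockSum k (set4 k x i p q r s) m hm = blockSum k x m hm := by
    intro m hm him
    simp only [blockSum, set4]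
    repeat rw [if_neg (by omega)]
  exact ⟨k - 2 - i, by omega, block_lt _ _ (by omega), fun j hj => block_eq _ _ (by omega)⟩

/-- If `x_{2i−1} < x_{2i} < x_{2i+1} < x_{2i+2}` (values `a,b,c,d`),
then `x(ac/bd)`, `x(ad/bc)`, `x(bc/ad)`, `x(bd/ac)`, `x(cd/ab)` are all `≺`-smaller
than `x = x(ab/cd)`. -/
theorem statement13 (k : ℕ) (hk : 1 ≤ k) (I : Finset ℕ) (hI : I.card = 2 * k)
    (x : PermOn k I) (i : ℕ) (hi : i + 1 < k)
    (a b c d : ℕ)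
    (ha : a = x.1 ⟨2 * i, by omega⟩) (hb : b = x.1 ⟨2 * i + 1, by omega⟩)
    (hc : c = x.1 ⟨2 * i + 2, by omega⟩) (hd : d = x.1 ⟨2 * i + 3, by omega⟩)
    (hab : a < b) (hbc : b < c) (hcd : c < d) :
    PermLt k (set4 k x.1 i a c b d) x.1 ∧
    PermLt k (set4 k x.1 i a d b c) x.1 ∧
    PermLt k (set4 k x.1 i b c a d) x.1 ∧
    PermLt k (set4 k x.1 i b d a c) x.1 ∧
    PermLt k (set4 k x.1 i c d a b) x.1 := by
  subst ha hb hc hd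
  refine ⟨?_, ?_, ?_, ?_, ?_⟩ <;> exact permLt_set4 k x.1 i hi _ _ _ _ (by omega)
end
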